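/- For any coin process X with spectral inf-entropy H_(X) > 0 and any target process Y, the infimum achievable rate of the interval algorithm satisfies R*_int(X,Y) ≤ H̄(Y)/H_(X), where H̄(Y) is the spectral sup-entropy of Y. -/

import Mathlib

open MeasureTheory Filter
open scoped ENNReal Classical

noncomputable section

namespace RNG

variable {𝒳 𝒴 : Type*}

/-- The length-`m` prefix of an infinite sequence, as a tuple. -/
def pre (ω : ℕ → 𝒳) (m : ℕ) : Fin m → 𝒳 := fun i => ω i

/-- The length-`m` prefix of an infinite sequence, as a list. -/
def preL (ω : ℕ → 𝒳) (m : ℕ) : List 𝒳 := (List.range m).map ω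

/-- `P_{X^m}(x^m)` : the probability of the cylinder set of a finite string `x^m`,
for a process with law `μ`. -/
def cylP [MeasurableSpace 𝒳] (μ : Measure (ℕ → 𝒳)) {m : ℕ} (x : Fin m → 𝒳) : ℝ :=
  (μ {ω | ∀ i : Fin m, ω i = x i}).toReal

/-- Validity (exact generation) of an algorithm `φ` (given as a full-tree function on finite
coin strings, `none` playing the role of `⊥`): for every target value `y`, the probability
that the algorithm terminates with output `y` equals `PY y`. -/
def Valid {B : Type*} [MeasurableSpace 𝒳] (μ : Measure (ℕ → 𝒳)) (PY : B → ℝ)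
    (φ : List 𝒳 → Option B) : Prop :=
  ∀ y : B,
    (μ {ω | ∃ i : ℕ, φ (preL ω i) = some y ∧ ∀ j < i, φ (preL ω j) = none}).toReal = PY y

/-- Strict lexicographic order on strings. -/
def lexLt [LT 𝒳] {m : ℕ} (x' x : Fin m → 𝒳) : Prop :=
  ∃ i : Fin m, (∀ j : Fin m, j < i → x' j = x j) ∧ x' i < x i

/-- The subinterval of `[0,1)` assigned to the string `x` by the interval algorithm:
strings are arranged in lexicographic order, `x` receiving an interval of length `P x`. -/
def itv [LT 𝒳] [Fintype 𝒳] {m : ℕ} (P : (Fin m → 𝒳) → ℝ) (x : Fin m → 𝒳) : Set ℝ :=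
  Set.Ico (∑ x' ∈ Finset.univ.filter (fun x' => lexLt x' x), P x')
    ((∑ x' ∈ Finset.univ.filter (fun x' => lexLt x' x), P x') + P x)

/-- The interval algorithm generating `Y^n` (target law `ν`) from the coin process `μ`
has stopped after at most `m` coin symbols on the sample `ω`, i.e. the coin interval
`I_{x^m}` is contained in some target interval `J_{y^n}`. -/
def IntStopped [LinearOrder 𝒳] [Fintype 𝒳] [LinearOrder 𝒴] [Fintype 𝒴]
    [MeasurableSpace 𝒳] [MeasurableSpace 𝒴]
    (μ : Measure (ℕ → 𝒳)) (ν : Measure (ℕ → 𝒴)) (n m : ℕ) (ω : ℕ → 𝒳) : Prop :=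
  ∃ y : Fin n → 𝒴, itv (fun x : Fin m → 𝒳 => cylP μ x) (pre ω m)
      ⊆ itv (fun y' : Fin n → 𝒴 => cylP ν y') y

/-- A rate `R` is achievable by the interval algorithm:
`Pr(T_n > nR) → 0` (the stopping time `T_n` is `ℕ`-valued, so `T_n > nR ↔ T_n > ⌊nR⌋`). -/
def IntAchievable [LinearOrder 𝒳] [Fintype 𝒳] [LinearOrder 𝒴] [Fintype 𝒴]
    [MeasurableSpace 𝒳] [MeasurableSpace 𝒴]
    (μ : Measure (ℕ → 𝒳)) (ν : Measure (ℕ → 𝒴)) (R : ℝ) : Prop :=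
  0 ≤ R ∧ Tendsto (fun n : ℕ =>
      (μ {ω | ¬ IntStopped μ ν n ⌊(n : ℝ) * R⌋₊ ω}).toReal) atTop (nhds 0)

/-- `R⋆_int(X,Y)` : the infimum rate achievable by the interval algorithm. -/
def Rint [LinearOrder 𝒳] [Fintype 𝒳] [LinearOrder 𝒴] [Fintype 𝒴]
    [MeasurableSpace 𝒳] [MeasurableSpace 𝒴]
    (μ : Measure (ℕ → 𝒳)) (ν : Measure (ℕ → 𝒴)) : ℝ :=
  sInf {R : ℝ | IntAchievable μ ν R}

/-- A rate `R` is achievable by some sequence of valid algorithms: for each `n` there is a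
valid algorithm `φ n` generating `Y^n` and `Pr(T_n > nR) → 0`. -/
def Achievable [MeasurableSpace 𝒳] [MeasurableSpace 𝒴]
    (μ : Measure (ℕ → 𝒳)) (ν : Measure (ℕ → 𝒴)) (R : ℝ) : Prop :=
  0 ≤ R ∧ ∃ φ : (n : ℕ) → List 𝒳 → Option (Fin n → 𝒴),
    (∀ n : ℕ, Valid μ (fun y : Fin n → 𝒴 => cylP ν y) (φ n)) ∧
    Tendsto (fun n : ℕ =>
      (μ {ω | ∀ i ≤ ⌊(n : ℝ) * R⌋₊, φ n (preL ω i) = none}).toReal) atTop (nhds 0)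

/-- `R⋆(X,Y)` : the infimum rate achievable over all valid algorithms. -/
def Rstar [MeasurableSpace 𝒳] [MeasurableSpace 𝒴]
    (μ : Measure (ℕ → 𝒳)) (ν : Measure (ℕ → 𝒴)) : ℝ :=
  sInf {R : ℝ | Achievable μ ν R}

/-- The expected stopping time `E[T_n]` of the interval algorithm, via `E[T] = ∑_m Pr(T>m)`. -/
def intAvgT [LinearOrder 𝒳] [Fintype 𝒳] [LinearOrder 𝒴] [Fintype 𝒴]
    [MeasurableSpace 𝒳] [MeasurableSpace 𝒴]
    (μ : Measure (ℕ → 𝒳)) (ν : Measure (ℕ → 𝒴)) (n : ℕ) : ℝ≥0∞ :=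
  ∑' m : ℕ, μ {ω | ¬ IntStopped μ ν n m ω}

/-- A rate `L` is average achievable by the interval algorithm: `limsup E[T_n]/n ≤ L`. -/
def IntAvgAchievable [LinearOrder 𝒳] [Fintype 𝒳] [LinearOrder 𝒴] [Fintype 𝒴]
    [MeasurableSpace 𝒳] [MeasurableSpace 𝒴]
    (μ : Measure (ℕ → 𝒳)) (ν : Measure (ℕ → 𝒴)) (L : ℝ≥0∞) : Prop :=
  limsup (fun n : ℕ => intAvgT μ ν n / (n : ℝ≥0∞)) atTop ≤ L

/-- `L⋆_int(X,Y)` : the infimum average achievable rate of the interval algorithm. -/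
def Lint [LinearOrder 𝒳] [Fintype 𝒳] [LinearOrder 𝒴] [Fintype 𝒴]
    [MeasurableSpace 𝒳] [MeasurableSpace 𝒴]
    (μ : Measure (ℕ → 𝒳)) (ν : Measure (ℕ → 𝒴)) : ℝ≥0∞ :=
  sInf {L : ℝ≥0∞ | IntAvgAchievable μ ν L}

/-- A rate `L` is average achievable by some sequence of valid algorithms. -/
def AvgAchievable [MeasurableSpace 𝒳] [MeasurableSpace 𝒴]
    (μ : Measure (ℕ → 𝒳)) (ν : Measure (ℕ → 𝒴)) (L : ℝ≥0∞) : Prop :=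
  ∃ φ : (n : ℕ) → List 𝒳 → Option (Fin n → 𝒴),
    (∀ n : ℕ, Valid μ (fun y : Fin n → 𝒴 => cylP ν y) (φ n)) ∧
    limsup (fun n : ℕ =>
      (∑' m : ℕ, μ {ω | ∀ i ≤ m, φ n (preL ω i) = none}) / (n : ℝ≥0∞)) atTop ≤ L

/-- `L⋆(X,Y)` : the infimum average achievable rate over all valid algorithms. -/
def Lstar [MeasurableSpace 𝒳] [MeasurableSpace 𝒴]
    (μ : Measure (ℕ → 𝒳)) (ν : Measure (ℕ → 𝒴)) : ℝ≥0∞ :=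
  sInf {L : ℝ≥0∞ | AvgAchievable μ ν L}

/-- The spectral sup-entropy `H̄(X)`: the event `(1/m) log(1/P_{X^m}(X^m)) ≥ λ` is
`P_{X^m}(X^m) ≤ 2^{-mλ}`. -/
def specSup [MeasurableSpace 𝒳] (μ : Measure (ℕ → 𝒳)) : ℝ :=
  sInf {lam : ℝ | Tendsto (fun m : ℕ =>
    (μ {ω | cylP μ (pre ω m) ≤ (2 : ℝ) ^ (-((m : ℝ) * lam))}).toReal) atTop (nhds 0)}

/-- The spectral inf-entropy `H̲(X)`: the event `(1/m) log(1/P_{X^m}(X^m)) ≤ λ` is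
`P_{X^m}(X^m) ≥ 2^{-mλ}`. -/
def specInf [MeasurableSpace 𝒳] (μ : Measure (ℕ → 𝒳)) : ℝ :=
  sSup {lam : ℝ | Tendsto (fun m : ℕ =>
    (μ {ω | (2 : ℝ) ^ (-((m : ℝ) * lam)) ≤ cylP μ (pre ω m)}).toReal) atTop (nhds 0)}

/-- The (sup-)entropy rate `H(X) = limsup (1/m) H(X^m)`. -/
def entRate [MeasurableSpace 𝒳] [Fintype 𝒳] (μ : Measure (ℕ → 𝒳)) : ℝ :=
  limsup (fun m : ℕ =>
    (∑ x : Fin m → 𝒳, cylP μ x * Real.logb 2 (1 / cylP μ x)) / (m : ℝ)) atTop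

/-- Upper-tail condition: `Pr((1/m) log(1/P_{X^m}(X^m)) ≥ H̄(X)+δ) ≤ K/m²` eventually. -/
def UpperTail [MeasurableSpace 𝒳] (μ : Measure (ℕ → 𝒳)) : Prop :=
  ∀ δ : ℝ, 0 < δ → ∃ (K : ℝ) (m₀ : ℕ), ∀ m : ℕ, m₀ ≤ m →
    (μ {ω | cylP μ (pre ω m) ≤ (2 : ℝ) ^ (-((m : ℝ) * (specSup μ + δ)))}).toReal
      ≤ K / (m : ℝ) ^ 2

/-- Lower-tail condition: `Pr((1/m) log(1/P_{X^m}(X^m)) ≤ H̲(X)−δ) ≤ K/m²` eventually. -/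
def LowerTail [MeasurableSpace 𝒳] (μ : Measure (ℕ → 𝒳)) : Prop :=
  ∀ δ : ℝ, 0 < δ → ∃ (K : ℝ) (m₀ : ℕ), ∀ m : ℕ, m₀ ≤ m →
    (μ {ω | (2 : ℝ) ^ (-((m : ℝ) * (specInf μ - δ))) ≤ cylP μ (pre ω m)}).toReal
      ≤ K / (m : ℝ) ^ 2

/-- The finite-dimensional distributions of a Markov chain with initial distribution `q`
and transition matrix `W` (`W x x'` is the transition probability from `x` to `x'`). -/
def markovP (q : 𝒳 → ℝ) (W : 𝒳 → 𝒳 → ℝ) : (m : ℕ) → (Fin m → 𝒳) → ℝ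
  | 0, _ => 1
  | m + 1, x => q (x 0) * ∏ i : Fin m, W (x i.castSucc) (x i.succ)

/-- `μ` is the law of the Markov chain with initial distribution `q` and transition matrix `W`. -/
def IsMarkovMeasure [MeasurableSpace 𝒳] (μ : Measure (ℕ → 𝒳)) (q : 𝒳 → ℝ)
    (W : 𝒳 → 𝒳 → ℝ) : Prop :=
  ∀ (m : ℕ) (x : Fin m → 𝒳), cylP μ x = markovP q W m x

/-- `W` is a (row-)stochastic transition matrix. -/
def IsTransMat [Fintype 𝒳] (W : 𝒳 → 𝒳 → ℝ) : Prop :=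
  (∀ x x', 0 ≤ W x x') ∧ ∀ x, ∑ x', W x x' = 1

/-- Irreducibility: any state reaches any other in some `k ≥ 1` steps. -/
def IrreducibleMat [Fintype 𝒳] [DecidableEq 𝒳] (W : Matrix 𝒳 𝒳 ℝ) : Prop :=
  ∀ x x' : 𝒳, ∃ k : ℕ, 1 ≤ k ∧ 0 < (W ^ k) x x'

/-- `π` is a stationary distribution of `W`. -/
def IsStationary [Fintype 𝒳] (π : 𝒳 → ℝ) (W : 𝒳 → 𝒳 → ℝ) : Prop :=
  (∀ x, 0 ≤ π x) ∧ (∑ x, π x = 1) ∧ ∀ x, ∑ x', π x' * W x' x = π x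

/-- `q` is a probability distribution (initial distribution). -/
def IsInitial [Fintype 𝒳] (q : 𝒳 → ℝ) : Prop :=
  (∀ x, 0 ≤ q x) ∧ ∑ x, q x = 1

/-- The entropy rate `H^W(X) = Σ_{x',x} π(x') W(x|x') log (1/W(x|x'))` of a stationary
Markov chain. -/
def matEnt [Fintype 𝒳] (π : 𝒳 → ℝ) (W : 𝒳 → 𝒳 → ℝ) : ℝ :=
  ∑ x' : 𝒳, ∑ x : 𝒳, π x' * W x' x * Real.logb 2 (1 / W x' x)

/-- The weight `w(ξ) = Pr(Y_1 ∈ 𝒴_ξ)` of the irreducible class `ξ` under the initial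
distribution `q`, where `c` assigns to each state its class. -/
def wgt [Fintype 𝒴] {r : ℕ} (c : 𝒴 → Fin r) (q : 𝒴 → ℝ) (ξ : Fin r) : ℝ :=
  ∑ y ∈ Finset.univ.filter (fun y => c y = ξ), q y

/-- The binary entropy function (base 2). -/
def binEnt (t : ℝ) : ℝ := t * Real.logb 2 (1 / t) + (1 - t) * Real.logb 2 (1 / (1 - t))

end RNG

namespace RNG

section Intervals

variable {α γ : Type*} [Fintype α] [LinearOrder γ]

theorem sum_lt_add_le {r : α → α → Prop} [DecidableRel r] {f : α → γ}
    (hr : ∀ x z, r x z ↔ f x < f z) (P : α → ℝ) (hP : ∀ x, 0 ≤ P x) {x z : α} (h : r x z) :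
    (∑ x' ∈ Finset.univ.filter (fun x' => r x' x), P x') + P x
      ≤ ∑ x' ∈ Finset.univ.filter (fun x' => r x' z), P x' := by
  rw [add_comm, ← Finset.sum_insert (by simp [hr])]
  refine Finset.sum_le_sum_of_subset_of_nonneg ?_ fun i _ _ => hP i
  intro w hw
  simp only [Finset.mem_insert, Finset.mem_filter, Finset.mem_univ, true_and] at hw ⊢
  rcases hw with rfl | hw
  · exact h
  · exact (hr _ _).2 (((hr _ _).1 hw).trans ((hr _ _).1 h))

theorem exists_mem_Ico_of_sum_lt {r : α → α → Prop} [DecidableRel r] {f : α → γ}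
    (hr : ∀ x z, r x z ↔ f x < f z) (hf : Function.Injective f) (P : α → ℝ)
    {t : ℝ} (h0 : 0 ≤ t) (h1 : t < ∑ x, P x) :
    ∃ x, t ∈ Set.Ico (∑ x' ∈ Finset.univ.filter (fun x' => r x' x), P x')
      ((∑ x' ∈ Finset.univ.filter (fun x' => r x' x), P x') + P x) := by
  have step : ∀ s : Finset α, (∀ x ∈ s, ∀ z, r z x → z ∈ s) → t < ∑ x ∈ s, P x →
      ∃ x, t ∈ Set.Ico (∑ x' ∈ Finset.univ.filter (fun x' => r x' x), P x')
        ((∑ x' ∈ Finset.univ.filter (fun x' => r x' x), P x') + P x) := by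
    intro s
    induction s using Finset.strongInduction with
    | H s ih =>
      intro hs ht
      have hne : s.Nonempty := by
        rw [Finset.nonempty_iff_ne_empty]
        rintro rfl
        simp at ht
        linarith
      obtain ⟨x, hx, hmax⟩ := s.exists_max_image f hne
      have hers : Finset.univ.filter (fun x' => r x' x) = s.erase x := by
        ext z
        simp only [Finset.mem_filter, Finset.mem_univ, true_and, Finset.mem_erase]
        refine ⟨fun hz => ⟨fun h => by simp [h, hr] at hz, hs x hx z hz⟩, fun hz => ?_⟩
        exact (hr _ _).2 (lt_of_le_of_ne (hmax z hz.2) fun h => hz.1 (hf h))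
      have hsum : (∑ x' ∈ s.erase x, P x') + P x = ∑ x' ∈ s, P x' :=
        Finset.sum_erase_add _ _ hx
      by_cases hl : ∑ x' ∈ s.erase x, P x' ≤ t
      · exact ⟨x, by rw [hers]; exact ⟨hl, by linarith⟩⟩
      · refine ih _ (Finset.erase_ssubset hx) ?_ (not_le.1 hl)
        intro w hw z hz
        rw [← hers] at hw ⊢
        simp only [Finset.mem_filter, Finset.mem_univ, true_and] at hw ⊢
        exact (hr _ _).2 (((hr _ _).1 hz).trans ((hr _ _).1 hw))
  exact step Finset.univ (fun _ _ _ _ => Finset.mem_univ _) h1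

end Intervals

theorem lexLt_iff {𝒳 : Type*} [LinearOrder 𝒳] {m : ℕ} (x' x : Fin m → 𝒳) :
    lexLt x' x ↔ toLex x' < toLex x := Iff.rfl

section Itv

variable {𝒳 : Type*} [LinearOrder 𝒳] [Fintype 𝒳] {m : ℕ}

theorem pairwise_disjoint_itv (P : (Fin m → 𝒳) → ℝ) (hP : ∀ x, 0 ≤ P x) :
    Pairwise (Function.onFun Disjoint (itv P)) := by
  have key : ∀ x z : Fin m → 𝒳, lexLt x z → Disjoint (itv P x) (itv P z) := by
    intro x z h
    rw [Set.disjoint_left]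
    intro t ht ht'
    have := sum_lt_add_le lexLt_iff P hP h
    exact absurd (ht.2.trans_le this) (not_lt.2 ht'.1)
  intro x z hxz
  rcases lt_or_gt_of_ne (toLex.injective.ne hxz :
      (toLex x : Lex (Fin m → 𝒳)) ≠ toLex z) with h | h
  · exact key _ _ h
  · exact (key _ _ h).symm

theorem itv_subset_Ico (P : (Fin m → 𝒳) → ℝ) (hP : ∀ x, 0 ≤ P x) (x : Fin m → 𝒳) :
    itv P x ⊆ Set.Ico 0 (∑ x', P x') := by
  rw [itv]
  refine Set.Ico_subset_Ico (Finset.sum_nonneg fun i _ => hP i) ?_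
  have hx : x ∉ Finset.univ.filter (fun x' => lexLt x' x) := fun h =>
    lt_irrefl _ ((lexLt_iff _ _).1 (Finset.mem_filter.1 h).2)
  rw [add_comm, ← Finset.sum_insert hx]
  exact Finset.sum_le_sum_of_subset_of_nonneg (Finset.subset_univ _) fun i _ _ => hP i

theorem exists_mem_itv (P : (Fin m → 𝒳) → ℝ) {t : ℝ} (ht : t ∈ Set.Ico 0 (∑ x', P x')) :
    ∃ x, t ∈ itv P x :=
  exists_mem_Ico_of_sum_lt lexLt_iff toLex.injective P ht.1 ht.2

theorem volume_itv (P : (Fin m → 𝒳) → ℝ) (x : Fin m → 𝒳) :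
    volume (itv P x) = ENNReal.ofReal (P x) := by
  rw [itv, Real.volume_Ico, add_sub_cancel_left]

theorem measurableSet_itv (P : (Fin m → 𝒳) → ℝ) (x : Fin m → 𝒳) : MeasurableSet (itv P x) :=
  measurableSet_Ico

variable {𝒴 : Type*} [LinearOrder 𝒴] [Fintype 𝒴] {n : ℕ}

/-- The coin intervals shorter than `ε` that fit in no target interval have total length at most
the total length of the target intervals outside `G`, plus `2ε` for each one in `G`. -/
theorem sum_not_subset_itv_le (P : (Fin m → 𝒳) → ℝ) (hP : ∀ x, 0 ≤ P x) (hP1 : ∑ x, P x = 1)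
    (Q : (Fin n → 𝒴) → ℝ) (hQ : ∀ y, 0 ≤ Q y) (hQ1 : ∑ y, Q y = 1) {ε : ℝ} (hε : 0 ≤ ε)
    (A : Finset (Fin m → 𝒳)) (hA : ∀ x ∈ A, P x < ε ∧ ∀ y, ¬ itv P x ⊆ itv Q y)
    (G : Finset (Fin n → 𝒴)) :
    ∑ x ∈ A, P x ≤ (∑ y ∈ Gᶜ, Q y) + G.card * (2 * ε) := by
  set l : (Fin n → 𝒴) → ℝ := fun y => ∑ y' ∈ Finset.univ.filter (fun y' => lexLt y' y), Q y'
  have hsub : (⋃ x ∈ A, itv P x) ⊆ (⋃ y ∈ Gᶜ, itv Q y) ∪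
      ⋃ y ∈ G, (Set.Icc (l y) (l y + ε) ∪ Set.Icc (l y + Q y - ε) (l y + Q y)) := by
    intro t ht
    simp only [Set.mem_iUnion] at ht
    obtain ⟨x, hx, htx⟩ := ht
    have ht1 := itv_subset_Ico P hP x htx
    rw [hP1, ← hQ1] at ht1
    obtain ⟨y, hy⟩ := exists_mem_itv Q ht1
    by_cases hyG : y ∈ G
    · right
      simp only [Set.mem_iUnion]
      refine ⟨y, hyG, ?_⟩
      by_contra hcon
      refine (hA x hx).2 y ?_
      have hlt := (hA x hx).1
      simp only [Set.mem_union, Set.mem_Icc, not_or, not_and, not_le] at hcon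
      obtain ⟨hc1, hc2⟩ := hcon
      obtain ⟨hy1, hy2⟩ := hy
      have hc1 := hc1 hy1
      have hc2 : t < l y + Q y - ε := by
        by_contra hge
        exact absurd (hc2 (not_lt.1 hge)) (not_lt.2 hy2.le)
      obtain ⟨hx1, hx2⟩ := htx
      refine Set.Ico_subset_Ico ?_ ?_
      · change l y ≤ _
        linarith
      · change _ ≤ l y + Q y
        linarith
    · left
      simp only [Set.mem_iUnion]
      exact ⟨y, by simpa using hyG, hy⟩
  have hvol := measure_mono (μ := volume) hsub
  rw [measure_biUnion_finset ((pairwise_disjoint_itv P hP).set_pairwise _)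
    fun x _ => measurableSet_itv P x] at hvol
  have hR : volume ((⋃ y ∈ Gᶜ, itv Q y) ∪
      ⋃ y ∈ G, (Set.Icc (l y) (l y + ε) ∪ Set.Icc (l y + Q y - ε) (l y + Q y)))
      ≤ ENNReal.ofReal ((∑ y ∈ Gᶜ, Q y) + G.card * (2 * ε)) := by
    rw [ENNReal.ofReal_add (Finset.sum_nonneg fun i _ => hQ i) (by positivity)]
    refine (measure_union_le _ _).trans (add_le_add ?_ ?_)
    · refine (measure_biUnion_finset_le _ _).trans ?_
      rw [ENNReal.ofReal_sum_of_nonneg fun i _ => hQ i]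
      simp only [volume_itv, le_refl]
    · refine (measure_biUnion_finset_le _ _).trans ?_
      refine (Finset.sum_le_card_nsmul _ _ (ENNReal.ofReal (2 * ε)) fun y _ => ?_).trans ?_
      · refine (measure_union_le _ _).trans ?_
        rw [Real.volume_Icc, Real.volume_Icc, ← ENNReal.ofReal_add (by linarith) (by linarith)]
        refine ENNReal.ofReal_le_ofReal ?_
        linarith
      · rw [nsmul_eq_mul, ENNReal.ofReal_mul (Nat.cast_nonneg _), ENNReal.ofReal_natCast]
  have hfin := hvol.trans hR
  simp only [volume_itv] at hfin
  rw [← ENNReal.ofReal_sum_of_nonneg fun i _ => hP i] at hfin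
  refine (ENNReal.ofReal_le_ofReal_iff ?_).1 hfin
  exact add_nonneg (Finset.sum_nonneg fun i _ => hQ i) (by positivity)

end Itv

section Cylinder

variable {𝒳 : Type*} [MeasurableSpace 𝒳]

theorem cylP_nonneg (μ : Measure (ℕ → 𝒳)) {m : ℕ} (x : Fin m → 𝒳) : 0 ≤ cylP μ x :=
  ENNReal.toReal_nonneg

variable [Fintype 𝒳] [DiscreteMeasurableSpace 𝒳]

theorem toReal_measure_pre_mem (μ : Measure (ℕ → 𝒳)) [IsProbabilityMeasure μ] {m : ℕ}
    (A : Finset (Fin m → 𝒳)) :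
    (μ {ω | pre ω m ∈ A}).toReal = ∑ x ∈ A, cylP μ x := by
  have hm : Measurable (fun ω : ℕ → 𝒳 => pre ω m) :=
    measurable_pi_lambda _ fun i => measurable_pi_apply _
  have h := sum_measureReal_preimage_singleton (μ := μ) A
    (f := fun ω : ℕ → 𝒳 => pre ω m) fun y _ => hm (measurableSet_singleton y)
  refine h.symm.trans (Finset.sum_congr rfl fun x _ => ?_)
  rw [cylP, Measure.real]
  congr 2
  ext ω
  simp [pre, funext_iff]

theorem sum_cylP (μ : Measure (ℕ → 𝒳)) [IsProbabilityMeasure μ] (m : ℕ) :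
    ∑ x : Fin m → 𝒳, cylP μ x = 1 := by
  rw [← toReal_measure_pre_mem]
  simp

theorem cylP_le_one (μ : Measure (ℕ → 𝒳)) [IsProbabilityMeasure μ] {m : ℕ} (x : Fin m → 𝒳) :
    cylP μ x ≤ 1 := by
  rw [← sum_cylP μ m]
  exact Finset.single_le_sum (fun i _ => cylP_nonneg μ i) (Finset.mem_univ x)

theorem specSup_set_nonneg (ν : Measure (ℕ → 𝒳)) [IsProbabilityMeasure ν] {b : ℝ}
    (hb : Tendsto (fun m : ℕ =>
      (ν {ω | cylP ν (pre ω m) ≤ (2 : ℝ) ^ (-((m : ℝ) * b))}).toReal) atTop (nhds 0)) :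
    0 ≤ b := by
  by_contra! hneg
  have h1 : ∀ m : ℕ, (ν {ω | cylP ν (pre ω m) ≤ (2 : ℝ) ^ (-((m : ℝ) * b))}).toReal = 1 := by
    intro m
    have : {ω | cylP ν (pre ω m) ≤ (2 : ℝ) ^ (-((m : ℝ) * b))} = Set.univ := by
      refine Set.eq_univ_of_forall fun ω => (cylP_le_one ν _).trans ?_
      refine Real.one_le_rpow (by norm_num) ?_
      have : (m : ℝ) * b ≤ 0 := mul_nonpos_of_nonneg_of_nonpos (by positivity) hneg.le
      linarith
    simp [this]
  simp only [h1] at hb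
  exact one_ne_zero (tendsto_nhds_unique tendsto_const_nhds hb)

theorem specSup_nonneg (ν : Measure (ℕ → 𝒳)) [IsProbabilityMeasure ν] : 0 ≤ specSup ν :=
  Real.sInf_nonneg fun _ hb => specSup_set_nonneg ν hb

theorem tendsto_specSup_card (ν : Measure (ℕ → 𝒳)) [IsProbabilityMeasure ν] :
    Tendsto (fun m : ℕ => (ν {ω | cylP ν (pre ω m)
      ≤ (2 : ℝ) ^ (-((m : ℝ) * (Fintype.card 𝒳 : ℝ)))}).toReal) atTop (nhds 0) := by
  set c := Fintype.card 𝒳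
  have hc : (c : ℝ) / 2 ^ c < 1 := by
    rw [div_lt_one (by positivity)]
    exact_mod_cast Nat.lt_two_pow_self
  refine squeeze_zero (fun _ => ENNReal.toReal_nonneg) (fun m => ?_)
    (tendsto_pow_atTop_nhds_zero_of_lt_one (by positivity) hc)
  have hset : {ω : ℕ → 𝒳 | cylP ν (pre ω m) ≤ (2 : ℝ) ^ (-((m : ℝ) * (c : ℝ)))}
      = {ω | pre ω m ∈ Finset.univ.filter fun x : Fin m → 𝒳 =>
          cylP ν x ≤ (2 : ℝ) ^ (-((m : ℝ) * (c : ℝ)))} := by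
    ext ω
    simp
  rw [hset, toReal_measure_pre_mem]
  refine (Finset.sum_le_card_nsmul _ _ ((2 : ℝ) ^ (-((m : ℝ) * (c : ℝ)))) fun x hx =>
    (Finset.mem_filter.1 hx).2).trans ?_
  rw [nsmul_eq_mul]
  have hcard : (((Finset.univ.filter fun x : Fin m → 𝒳 =>
      cylP ν x ≤ (2 : ℝ) ^ (-((m : ℝ) * (c : ℝ)))).card : ℕ) : ℝ) ≤ (c : ℝ) ^ m := by
    have := Finset.card_filter_le (Finset.univ : Finset (Fin m → 𝒳))
      fun x => cylP ν x ≤ (2 : ℝ) ^ (-((m : ℝ) * (c : ℝ)))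
    rw [Finset.card_univ, Fintype.card_fun, Fintype.card_fin] at this
    exact_mod_cast this
  have hpow : (2 : ℝ) ^ (-((m : ℝ) * (c : ℝ))) = ((2 ^ c) ^ m)⁻¹ := by
    rw [Real.rpow_neg (by norm_num), ← Nat.cast_mul, Real.rpow_natCast, ← pow_mul, mul_comm]
  rw [div_pow, div_eq_mul_inv, hpow]
  gcongr
  rwa [hpow] at hcard

end Cylinder

section Rate

variable {𝒳 𝒴 : Type*} [Fintype 𝒳] [LinearOrder 𝒳] [MeasurableSpace 𝒳] [DiscreteMeasurableSpace 𝒳]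
  [Fintype 𝒴] [LinearOrder 𝒴] [MeasurableSpace 𝒴] [DiscreteMeasurableSpace 𝒴]

theorem measure_not_intStopped_le (μ : Measure (ℕ → 𝒳)) [IsProbabilityMeasure μ]
    (ν : Measure (ℕ → 𝒴)) [IsProbabilityMeasure ν] (n m : ℕ) {ε δ : ℝ} (hε : 0 ≤ ε)
    (hδ : 0 < δ) :
    (μ {ω | ¬ IntStopped μ ν n m ω}).toReal ≤ (μ {ω | ε ≤ cylP μ (pre ω m)}).toReal
      + ((ν {ω | cylP ν (pre ω n) ≤ δ}).toReal + δ⁻¹ * (2 * ε)) := by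
  set A : Finset (Fin m → 𝒳) := Finset.univ.filter fun x => cylP μ x < ε ∧
    ∀ y : Fin n → 𝒴, ¬ itv (fun x : Fin m → 𝒳 => cylP μ x) x
      ⊆ itv (fun y : Fin n → 𝒴 => cylP ν y) y
  set G : Finset (Fin n → 𝒴) := Finset.univ.filter fun y => δ < cylP ν y
  have hsub : {ω | ¬ IntStopped μ ν n m ω}
      ⊆ {ω | ε ≤ cylP μ (pre ω m)} ∪ {ω | pre ω m ∈ A} := by
    intro ω hω
    rcases le_or_gt ε (cylP μ (pre ω m)) with h | h
    · exact Or.inl h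
    · refine Or.inr (Finset.mem_filter.2 ⟨Finset.mem_univ _, h, ?_⟩)
      exact fun y hy => hω ⟨y, hy⟩
  have hbound : (μ {ω | ¬ IntStopped μ ν n m ω}).toReal
      ≤ (μ {ω | ε ≤ cylP μ (pre ω m)}).toReal + (μ {ω | pre ω m ∈ A}).toReal :=
    (measureReal_mono hsub).trans (measureReal_union_le _ _)
  have hbad : (ν {ω | cylP ν (pre ω n) ≤ δ}).toReal = ∑ y ∈ Gᶜ, cylP ν y := by
    rw [← toReal_measure_pre_mem]
    congr 2
    ext ω
    simp [G]
  have hcard : (G.card : ℝ) ≤ δ⁻¹ := by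
    have h : G.card • δ ≤ ∑ y ∈ G, cylP ν y :=
      Finset.card_nsmul_le_sum _ _ _ fun y hy => (Finset.mem_filter.1 hy).2.le
    have h' : ∑ y ∈ G, cylP ν y ≤ 1 := by
      rw [← sum_cylP ν n]
      exact Finset.sum_le_sum_of_subset_of_nonneg (Finset.subset_univ _)
        fun i _ _ => cylP_nonneg ν i
    rw [nsmul_eq_mul] at h
    rw [← one_div, le_div_iff₀ hδ]
    exact h.trans h'
  have hmain := sum_not_subset_itv_le (fun x : Fin m → 𝒳 => cylP μ x) (cylP_nonneg μ)
    (sum_cylP μ m) (fun y : Fin n → 𝒴 => cylP ν y) (cylP_nonneg ν) (sum_cylP ν n) hε A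
    (fun x hx => (Finset.mem_filter.1 hx).2) G
  rw [toReal_measure_pre_mem] at hbound
  rw [hbad]
  have : (G.card : ℝ) * (2 * ε) ≤ δ⁻¹ * (2 * ε) := by gcongr
  linarith

theorem intAchievable_of_lt_mul (μ : Measure (ℕ → 𝒳)) [IsProbabilityMeasure μ]
    (ν : Measure (ℕ → 𝒴)) [IsProbabilityMeasure ν] {R a b : ℝ} (hR : 0 < R) (ha : 0 < a)
    (hab : b < R * a)
    (hμ : Tendsto (fun m : ℕ =>
      (μ {ω | (2 : ℝ) ^ (-((m : ℝ) * a)) ≤ cylP μ (pre ω m)}).toReal) atTop (nhds 0))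
    (hν : Tendsto (fun m : ℕ =>
      (ν {ω | cylP ν (pre ω m) ≤ (2 : ℝ) ^ (-((m : ℝ) * b))}).toReal) atTop (nhds 0)) :
    IntAchievable μ ν R := by
  refine ⟨hR.le, ?_⟩
  have hfloor : Tendsto (fun n : ℕ => ⌊(n : ℝ) * R⌋₊) atTop atTop :=
    tendsto_nat_floor_atTop.comp (tendsto_natCast_atTop_atTop.atTop_mul_const hR)
  set q : ℝ := (2 : ℝ) ^ (b - R * a) with hq
  have hq1 : q < 1 := Real.rpow_lt_one_of_one_lt_of_neg (by norm_num) (by linarith)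
  have hgeo : Tendsto (fun n : ℕ => 2 * 2 ^ a * q ^ n) atTop (nhds 0) := by
    simpa using (tendsto_pow_atTop_nhds_zero_of_lt_one (by positivity) hq1).const_mul (2 * 2 ^ a)
  have hlim := (hμ.comp hfloor).add (hν.add hgeo)
  simp only [add_zero] at hlim
  refine squeeze_zero (fun _ => ENNReal.toReal_nonneg) (fun n => ?_) hlim
  refine (measure_not_intStopped_le μ ν n ⌊(n : ℝ) * R⌋₊
    (ε := (2 : ℝ) ^ (-((⌊(n : ℝ) * R⌋₊ : ℝ) * a))) (δ := (2 : ℝ) ^ (-((n : ℝ) * b)))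
    (by positivity) (by positivity)).trans ?_
  refine add_le_add le_rfl (add_le_add le_rfl ?_)
  have hfl : (n : ℝ) * R - 1 ≤ (⌊(n : ℝ) * R⌋₊ : ℝ) := (Nat.sub_one_lt_floor _).le
  have hexp : (n : ℝ) * b + -((⌊(n : ℝ) * R⌋₊ : ℝ) * a) ≤ a + (b - R * a) * n := by
    nlinarith [mul_le_mul_of_nonneg_right hfl ha.le]
  have h2 : (2 : ℝ) ^ ((n : ℝ) * b) * (2 : ℝ) ^ (-((⌊(n : ℝ) * R⌋₊ : ℝ) * a)) ≤ 2 ^ a * q ^ n := by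
    rw [hq, ← Real.rpow_natCast, ← Real.rpow_mul (by norm_num), ← Real.rpow_add (by norm_num),
      ← Real.rpow_add (by norm_num)]
    exact Real.rpow_le_rpow_of_exponent_le (by norm_num) hexp
  rw [← Real.rpow_neg (by norm_num), neg_neg]
  linarith

end Rate

end RNG

open RNG
/-- **Theorem 3, achievability part.** For any coin process `μ` with `H̲(X) > 0` and any
target process `ν`, the infimum achievable rate of the interval algorithm satisfies
`R⋆_int(X,Y) ≤ H̄(Y)/H̲(X)`. -/
theorem Rint_le_ratio
    {𝒳 𝒴 : Type*} [Fintype 𝒳] [LinearOrder 𝒳] [MeasurableSpace 𝒳] [DiscreteMeasurableSpace 𝒳]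
    [Fintype 𝒴] [LinearOrder 𝒴] [MeasurableSpace 𝒴] [DiscreteMeasurableSpace 𝒴]
    (μ : Measure (ℕ → 𝒳)) [IsProbabilityMeasure μ]
    (ν : Measure (ℕ → 𝒴)) [IsProbabilityMeasure ν]
    (hX : 0 < specInf μ) :
    Rint μ ν ≤ specSup ν / specInf μ := by
  have hratio : 0 ≤ specSup ν / specInf μ := div_nonneg (specSup_nonneg ν) hX.le
  refine le_of_forall_gt_imp_ge_of_dense fun R hR => ?_
  have hR0 : 0 < R := hratio.trans_lt hR
  refine csInf_le ⟨0, fun _ h => h.1⟩ ?_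
  rw [div_lt_iff₀ hX] at hR
  obtain ⟨b, hb, hbR⟩ := exists_lt_of_csInf_lt ⟨_, tendsto_specSup_card ν⟩ hR
  have hlt : max 0 (b / R) < specInf μ :=
    max_lt hX (by rw [div_lt_iff₀ hR0]; linarith)
  have hne : {lam : ℝ | Tendsto (fun m : ℕ =>
      (μ {ω | (2 : ℝ) ^ (-((m : ℝ) * lam)) ≤ cylP μ (pre ω m)}).toReal)
        atTop (nhds 0)}.Nonempty := by
    by_contra h
    rw [specInf, Set.not_nonempty_iff_eq_empty.1 h, Real.sSup_empty] at hX
    exact hX.false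
  obtain ⟨a, ha, haR⟩ := exists_lt_of_lt_csSup hne hlt
  have hba : b / R < a := (le_max_right _ _).trans_lt haR
  rw [div_lt_iff₀ hR0] at hba
  exact intAchievable_of_lt_mul μ ν hR0 ((le_max_left _ _).trans_lt haR) (by linarith) ha hb
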